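/- arXiv:2208.09173 — 11 statements merged into one kernel-verified Lean document; each statement's English description precedes it below -/
import Mathlib

section
/- Let m, l, k₀, k₁ be non-negative integers and let G be the presented group ⟨x, y, γ ∣ (γ^(2^m) y^(2^l))^(2^k₀), (x y x⁻² y⁻¹)^(2^k₁)⟩. Then the abelianization of G is an infinite cyclic group generated by the image of γ if and only if k₀ = k₁ = l = 0. -/
/-- If the abelianization of a presented group is generated by the image of one generator `j`, then
any assignment of generators to a commutative group that kills the relators and `j` is trivial. -/
theorem PresentedGroup.eq_one_of_zpowers_abelianization_eq_top {α A : Type*} [CommGroup A]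
    {rels : Set (FreeGroup α)} {j : α}
    (hj : Subgroup.zpowers (Abelianization.of (PresentedGroup.of j : PresentedGroup rels)) = ⊤)
    {f : α → A} (hf : ∀ r ∈ rels, FreeGroup.lift f r = 1) (hfj : f j = 1) (i : α) : f i = 1 := by
  obtain ⟨n, hn⟩ : Abelianization.of (PresentedGroup.of i : PresentedGroup rels) ∈
      Subgroup.zpowers (Abelianization.of (PresentedGroup.of j : PresentedGroup rels)) :=
    hj ▸ Subgroup.mem_top _
  have h := congrArg (Abelianization.lift (PresentedGroup.toGroup hf)) hn
  simpa [hfj] using h.symm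

/-- Lemma 6.2(1), homological computation: the abelianization of
⟨x, y, γ ∣ (γ^(2^m) y^(2^l))^(2^k₀), (x y x⁻² y⁻¹)^(2^k₁)⟩ is infinite cyclic
generated by the image of γ iff k₀ = k₁ = l = 0.  (x = 0, y = 1, γ = 2.) -/
theorem stmt2 (m l k₀ k₁ : ℕ) :
    ∀ (rels : Set (FreeGroup (Fin 3))),
      rels = {((FreeGroup.of 2) ^ (2 ^ m) * (FreeGroup.of 1) ^ (2 ^ l)) ^ (2 ^ k₀),
               (FreeGroup.of 0 * FreeGroup.of 1 * (FreeGroup.of 0) ^ (-2 : ℤ) * (FreeGroup.of 1)⁻¹) ^ (2 ^ k₁)} →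
      ((Nonempty (Abelianization (PresentedGroup rels) ≃* Multiplicative ℤ) ∧
        Subgroup.zpowers (Abelianization.of (PresentedGroup.of ((2 : Fin 3)) : PresentedGroup rels)) = ⊤) ↔
        (k₀ = 0 ∧ k₁ = 0 ∧ l = 0)) := by
  rintro rels rfl
  constructor
  · rintro ⟨-, hγ⟩
    have two_pow : ∀ n : ℕ, n ≠ 0 → Multiplicative.ofAdd (1 : ZMod 2) ^ 2 ^ n = 1 := fun n hn ↦ by
      rw [← ofAdd_nsmul, nsmul_one, Nat.cast_pow, Nat.cast_ofNat,
        show (2 : ZMod 2) = 0 from rfl, zero_pow hn, ofAdd_zero]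
    have nontriv : Multiplicative.ofAdd (1 : ZMod 2) ≠ 1 := by decide
    have hy : l + k₀ = 0 := by
      by_contra h
      refine nontriv (PresentedGroup.eq_one_of_zpowers_abelianization_eq_top hγ
        (f := ![1, Multiplicative.ofAdd (1 : ZMod 2), 1]) ?_ rfl 1)
      rintro r (rfl | rfl)
      · simpa [← pow_mul, ← pow_add] using two_pow _ h
      · simp
    have hx : k₁ = 0 := by
      by_contra h
      refine nontriv (PresentedGroup.eq_one_of_zpowers_abelianization_eq_top hγ
        (f := ![Multiplicative.ofAdd (1 : ZMod 2), 1, 1]) ?_ rfl 0)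
      rintro r (rfl | rfl)
      · simp
      · have hinv : Multiplicative.ofAdd (1 : ZMod 2) *
            (Multiplicative.ofAdd (1 : ZMod 2) ^ 2)⁻¹ = Multiplicative.ofAdd (1 : ZMod 2) := by decide
        simpa [hinv] using two_pow _ h
    omega
  · rintro ⟨rfl, rfl, rfl⟩
    set rels : Set (FreeGroup (Fin 3)) := {_, _}
    let gen (i : Fin 3) : Abelianization (PresentedGroup rels) :=
      Abelianization.of (PresentedGroup.of i)
    have hgen_rel : ∀ r ∈ rels, FreeGroup.lift gen r = 1 := fun r hr ↦ by
      have : FreeGroup.lift gen = Abelianization.of.comp (PresentedGroup.mk rels) := by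
        ext i; simp [gen, PresentedGroup.of]
      rw [this, MonoidHom.comp_apply, PresentedGroup.one_of_mem hr, map_one]
    have hx : gen 0 = 1 := by
      have h := hgen_rel _ (Set.mem_insert_of_mem _ rfl)
      simp only [pow_zero, pow_one, map_mul, map_zpow, map_inv, FreeGroup.lift_apply_of] at h
      rw [mul_right_comm (gen 0), mul_inv_cancel_right, ← zpow_one_add] at h
      simpa using h
    have hy : gen 1 = gen 2 ^ (-2 ^ m : ℤ) := by
      have h := hgen_rel _ (Set.mem_insert _ _)
      simp only [pow_zero, pow_one, map_mul, map_pow, FreeGroup.lift_apply_of] at h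
      rw [eq_inv_of_mul_eq_one_right h, zpow_neg]
      norm_cast
    let deg : Fin 3 → Multiplicative ℤ :=
      ![1, Multiplicative.ofAdd (-2 ^ m), Multiplicative.ofAdd 1]
    have hdeg : ∀ r ∈ rels, FreeGroup.lift deg r = 1 := by
      rintro r (rfl | rfl)
      · simp [deg, ← ofAdd_nsmul]
      · simp [deg]
    let e : Abelianization (PresentedGroup rels) ≃* Multiplicative ℤ :=
      MonoidHom.toMulEquiv (Abelianization.lift (PresentedGroup.toGroup hdeg))
        (zpowersHom _ (gen 2))
        (by
          ext i
          fin_cases i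
          · simpa [deg] using hx.symm
          · simpa [deg] using hy.symm
          · simp [deg, gen])
        (by ext; simp [deg, gen])
    exact ⟨⟨e⟩, (Subgroup.eq_top_iff' _).2 fun a ↦ ⟨(e a).toAdd, e.symm_apply_apply a⟩⟩
end

section
/- Let m be a non-negative integer, let g be a positive integer, and set n = 2^m · g. The presented group ⟨x, y, γ, μ ∣ γ^(2^m) y, x y x⁻² y⁻¹, γ μ⁻ᵍ⟩ is isomorphic to the presented group ⟨a, b ∣ a² bⁿ a⁻¹ b⁻ⁿ⟩, via an isomorphism sending x to a and μ to b. -/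
/-- Conjugating `x ^ 2` by `c⁻¹` gives `x`, written with either of two relators. -/
theorem sq_mul_conj_relator_eq_one_iff {G : Type*} [Group G] (x c : G) :
    x ^ 2 * c * x⁻¹ * c⁻¹ = 1 ↔ x * c⁻¹ * x ^ (-2 : ℤ) * c⁻¹⁻¹ = 1 := by
  rw [mul_inv_eq_one, mul_inv_eq_one, mul_inv_eq_iff_eq_mul, zpow_neg, mul_inv_eq_iff_eq_mul,
    eq_inv_mul_iff_mul_eq, ← mul_assoc, mul_inv_eq_iff_eq_mul, zpow_ofNat, eq_comm]

/-- Lemma 6.2(1), knot group: ⟨x, y, γ, μ ∣ γ^(2^m) y, x y x⁻² y⁻¹, γ μ⁻ᵍ⟩ ≅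
⟨a, b ∣ a² bⁿ a⁻¹ b⁻ⁿ⟩ with n = 2^m g, via x ↦ a, μ ↦ b.
(x = 0, y = 1, γ = 2, μ = 3; a = 0, b = 1.) -/
theorem stmt3 (m g : ℕ) (hg : 0 < g) (n : ℕ) (hn : n = 2 ^ m * g) :
    ∀ (rels₁ : Set (FreeGroup (Fin 4))) (rels₂ : Set (FreeGroup (Fin 2))),
      rels₁ = {(FreeGroup.of 2) ^ (2 ^ m) * FreeGroup.of 1,
               FreeGroup.of 0 * FreeGroup.of 1 * (FreeGroup.of 0) ^ (-2 : ℤ) * (FreeGroup.of 1)⁻¹,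
               FreeGroup.of 2 * (FreeGroup.of 3) ^ (-(g : ℤ))} →
      rels₂ = {(FreeGroup.of 0) ^ 2 * (FreeGroup.of 1) ^ n * (FreeGroup.of 0)⁻¹ *
                (FreeGroup.of 1) ^ (-(n : ℤ))} →
      ∃ e : PresentedGroup rels₁ ≃* PresentedGroup rels₂,
        e (PresentedGroup.of 0) = PresentedGroup.of 0 ∧
        e (PresentedGroup.of 3) = PresentedGroup.of 1 := by
  intro rels₁ rels₂ h₁ h₂
  have one₁ : ∀ r ∈ rels₁, PresentedGroup.mk rels₁ r = 1 :=
    fun r hr => PresentedGroup.one_of_mem hr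
  have rel₂ : (PresentedGroup.of 0 : PresentedGroup rels₂) ^ 2 * PresentedGroup.of 1 ^ n *
      (PresentedGroup.of 0)⁻¹ * (PresentedGroup.of 1 ^ n)⁻¹ = 1 := by
    have h := PresentedGroup.one_of_mem (rels := rels₂) (by rw [h₂]; exact Set.mem_singleton _)
    simp only [map_mul, map_pow, map_inv, zpow_neg, zpow_natCast] at h
    exact h
  have hγy : (PresentedGroup.of 2 : PresentedGroup rels₁) ^ 2 ^ m * PresentedGroup.of 1 = 1 := by
    have h := one₁ _ (by rw [h₁]; exact Or.inl rfl)
    simp only [map_mul, map_pow] at h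
    exact h
  have hxy : (PresentedGroup.of 0 : PresentedGroup rels₁) * PresentedGroup.of 1 *
      PresentedGroup.of 0 ^ (-2 : ℤ) * (PresentedGroup.of 1)⁻¹ = 1 := by
    have h := one₁ _ (by rw [h₁]; exact Or.inr (Or.inl rfl))
    simp only [map_mul, map_zpow, map_inv] at h
    exact h
  have hγ : (PresentedGroup.of 2 : PresentedGroup rels₁) = PresentedGroup.of 3 ^ g := by
    have h := one₁ _ (by rw [h₁]; exact Or.inr (Or.inr rfl))
    simp only [map_mul, zpow_neg, zpow_natCast, map_inv, map_pow] at h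
    exact mul_inv_eq_one.mp h
  have hy : (PresentedGroup.of 1 : PresentedGroup rels₁) = (PresentedGroup.of 3 ^ n)⁻¹ := by
    rw [eq_inv_of_mul_eq_one_right hγy, hγ, ← pow_mul, hn, mul_comm g]
  let v₁ : Fin 4 → PresentedGroup rels₂ :=
    ![PresentedGroup.of 0, (PresentedGroup.of 1 ^ n)⁻¹, PresentedGroup.of 1 ^ g,
      PresentedGroup.of 1]
  let v₂ : Fin 2 → PresentedGroup rels₁ := ![PresentedGroup.of 0, PresentedGroup.of 3]
  have hv₁ : ∀ r ∈ rels₁, FreeGroup.lift v₁ r = 1 := by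
    rw [h₁]
    rintro r (rfl | rfl | rfl)
    · simp [v₁, hn, ← pow_mul, mul_comm g]
    · simp only [map_mul, map_zpow, map_inv, FreeGroup.lift_apply_of]
      exact (sq_mul_conj_relator_eq_one_iff _ _).mp rel₂
    · simp [v₁]
  have hv₂ : ∀ r ∈ rels₂, FreeGroup.lift v₂ r = 1 := by
    rw [h₂]
    rintro r rfl
    rw [hy] at hxy
    simp only [map_mul, map_pow, map_inv, zpow_neg, zpow_natCast, FreeGroup.lift_apply_of]
    exact (sq_mul_conj_relator_eq_one_iff _ _).mpr hxy
  let f := PresentedGroup.toGroup hv₁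
  let k := PresentedGroup.toGroup hv₂
  have hkf : k.comp f = MonoidHom.id _ := by
    ext i
    fin_cases i <;> simp [f, k, v₁, v₂, hy, hγ]
  have hfk : f.comp k = MonoidHom.id _ := by
    ext i
    fin_cases i <;> simp [f, k, v₁, v₂]
  exact ⟨f.toMulEquiv k hkf hfk, by simp [f, v₁], by simp [f, v₁]⟩
end

section
/- Let m be a non-negative integer and g a positive integer. The presented group ⟨x, y, γ, μ ∣ γ^(2^m) (x y x⁻² y⁻¹), y, γ μ⁻ᵍ⟩ is an infinite cyclic group generated by the image of μ. -/
/-- A group generated by one element that some homomorphism sends to a generator of `ℤ` is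
infinite cyclic. -/
theorem nonempty_mulEquiv_int_of_zpowers_eq_top {G : Type*} [Group G] {a : G}
    (ha : Subgroup.zpowers a = ⊤) (f : G →* Multiplicative ℤ)
    (hf : f a = Multiplicative.ofAdd 1) : Nonempty (G ≃* Multiplicative ℤ) := by
  have hpow (k : ℤ) : f (a ^ k) = Multiplicative.ofAdd k := by
    rw [map_zpow, hf, ← ofAdd_zsmul, smul_eq_mul, mul_one]
  refine ⟨MulEquiv.ofBijective f ⟨(injective_iff_map_eq_one f).2 fun b hb => ?_, fun k =>
    ⟨a ^ k.toAdd, hpow _⟩⟩⟩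
  obtain ⟨k, rfl⟩ := Subgroup.mem_zpowers_iff.1 (ha ▸ Subgroup.mem_top b)
  rw [hpow, ofAdd_eq_one] at hb
  rw [hb, zpow_zero]


/-- Lemma 6.2(2): ⟨x, y, γ, μ ∣ γ^(2^m) (x y x⁻² y⁻¹), y, γ μ⁻ᵍ⟩ is infinite
cyclic generated by the image of μ.  (x = 0, y = 1, γ = 2, μ = 3.) -/
theorem stmt4 (m g : ℕ) (hg : 0 < g) :
    ∀ (rels : Set (FreeGroup (Fin 4))),
      rels = {(FreeGroup.of 2) ^ (2 ^ m) * (FreeGroup.of 0 * FreeGroup.of 1 * (FreeGroup.of 0) ^ (-2 : ℤ) * (FreeGroup.of 1)⁻¹),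
               FreeGroup.of 1,
               FreeGroup.of 2 * (FreeGroup.of 3) ^ (-(g : ℤ))} →
      (Nonempty (PresentedGroup rels ≃* Multiplicative ℤ) ∧
        Subgroup.zpowers (PresentedGroup.of ((3 : Fin 4)) : PresentedGroup rels) = ⊤) := by
  intro rels hrels
  have hy : (PresentedGroup.of 1 : PresentedGroup rels) = 1 :=
    PresentedGroup.one_of_mem (by simp [hrels])
  have hγ : (PresentedGroup.of 2 : PresentedGroup rels) = PresentedGroup.of 3 ^ (g : ℤ) := by
    have h : PresentedGroup.mk rels (FreeGroup.of 2 * FreeGroup.of 3 ^ (-(g : ℤ))) = 1 :=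
      PresentedGroup.one_of_mem (by simp [hrels])
    rw [map_mul, map_zpow, zpow_neg, mul_inv_eq_one] at h
    exact h
  have hx : (PresentedGroup.of 0 : PresentedGroup rels) = PresentedGroup.of 2 ^ 2 ^ m := by
    have h : PresentedGroup.mk rels (FreeGroup.of 2 ^ 2 ^ m * (FreeGroup.of 0 * FreeGroup.of 1 *
        FreeGroup.of 0 ^ (-2 : ℤ) * (FreeGroup.of 1)⁻¹)) = 1 :=
      PresentedGroup.one_of_mem (by simp [hrels])
    simp only [map_mul, map_pow, map_zpow, map_inv] at h
    change PresentedGroup.of 2 ^ 2 ^ m * (PresentedGroup.of 0 * PresentedGroup.of 1 *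
      PresentedGroup.of 0 ^ (-2 : ℤ) * (PresentedGroup.of 1)⁻¹) = 1 at h
    rw [hy] at h
    have hinv : (PresentedGroup.of 0 : PresentedGroup rels) * 1 *
        PresentedGroup.of 0 ^ (-2 : ℤ) * 1⁻¹ = (PresentedGroup.of 0)⁻¹ := by group
    rw [hinv, mul_inv_eq_one] at h
    exact h.symm
  have htop : Subgroup.zpowers (PresentedGroup.of (3 : Fin 4) : PresentedGroup rels) = ⊤ := by
    have hμ := Subgroup.mem_zpowers (PresentedGroup.of (3 : Fin 4) : PresentedGroup rels)
    have hγμ := hγ ▸ Subgroup.zpow_mem _ hμ g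
    rw [eq_top_iff, ← PresentedGroup.closure_range_of, Subgroup.closure_le]
    rintro _ ⟨i, rfl⟩
    fin_cases i
    · exact hx ▸ Subgroup.pow_mem _ hγμ _
    · exact hy ▸ Subgroup.one_mem _
    · exact hγμ
    · exact hμ
  let t : Multiplicative ℤ := Multiplicative.ofAdd 1
  let images : Fin 4 → Multiplicative ℤ := ![(t ^ g) ^ 2 ^ m, 1, t ^ g, t]
  have himages : ∀ r ∈ rels, FreeGroup.lift images r = 1 := by
    rw [hrels]
    rintro r (rfl | rfl | rfl)
    · simp only [map_mul, map_pow, map_zpow, map_inv, FreeGroup.lift_apply_of]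
      change (t ^ g) ^ 2 ^ m * ((t ^ g) ^ 2 ^ m * 1 * ((t ^ g) ^ 2 ^ m) ^ (-2 : ℤ) * 1⁻¹) = 1
      generalize (t ^ g) ^ 2 ^ m = s
      group
    · simp [images]
    · simp [images]
  exact ⟨nonempty_mulEquiv_int_of_zpowers_eq_top htop (PresentedGroup.toGroup himages)
    (PresentedGroup.toGroup.of himages), htop⟩
end

section
/- Let m be a non-negative integer, let g be a positive integer, and set n = 2^m · g. The presented group ⟨x, y, γ, μ ∣ γ^(2^m) y, x y x⁻² y, γ μ⁻ᵍ⟩ is isomorphic to the presented group ⟨a, b ∣ a² bⁿ a⁻¹ bⁿ⟩, via an isomorphism sending x to a and μ to b. -/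
/-- The relator `a c⁻¹ a⁻² c⁻¹` is conjugate to the inverse of `a² c a⁻¹ c`. -/
theorem mul_inv_mul_zpow_neg_two_mul_inv_eq_one_iff {G : Type*} [Group G] (a c : G) :
    a * c⁻¹ * a ^ (-2 : ℤ) * c⁻¹ = 1 ↔ a ^ 2 * c * a⁻¹ * c = 1 := by
  have h : a * c⁻¹ * a ^ (-2 : ℤ) * c⁻¹ = c * (a ^ 2 * c * a⁻¹ * c)⁻¹ * c⁻¹ := by
    group
  rw [h, conj_eq_one_iff, inv_eq_one]

/-- Lemma 6.2(3), knot group: ⟨x, y, γ, μ ∣ γ^(2^m) y, x y x⁻² y, γ μ⁻ᵍ⟩ ≅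
⟨a, b ∣ a² bⁿ a⁻¹ bⁿ⟩ with n = 2^m g, via x ↦ a, μ ↦ b.
(x = 0, y = 1, γ = 2, μ = 3; a = 0, b = 1.) -/
theorem stmt6 (m g : ℕ) (hg : 0 < g) (n : ℕ) (hn : n = 2 ^ m * g) :
    ∀ (rels₁ : Set (FreeGroup (Fin 4))) (rels₂ : Set (FreeGroup (Fin 2))),
      rels₁ = {(FreeGroup.of 2) ^ (2 ^ m) * FreeGroup.of 1,
               FreeGroup.of 0 * FreeGroup.of 1 * (FreeGroup.of 0) ^ (-2 : ℤ) * FreeGroup.of 1,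
               FreeGroup.of 2 * (FreeGroup.of 3) ^ (-(g : ℤ))} →
      rels₂ = {(FreeGroup.of 0) ^ 2 * (FreeGroup.of 1) ^ n * (FreeGroup.of 0)⁻¹ *
                (FreeGroup.of 1) ^ n} →
      ∃ e : PresentedGroup rels₁ ≃* PresentedGroup rels₂,
        e (PresentedGroup.of 0) = PresentedGroup.of 0 ∧
        e (PresentedGroup.of 3) = PresentedGroup.of 1 := by
  rintro rels₁ rels₂ h₁ h₂
  have hγy : (PresentedGroup.of 2 : PresentedGroup rels₁) ^ 2 ^ m * PresentedGroup.of 1 = 1 :=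
    PresentedGroup.one_of_mem (rels := rels₁) (by simp [h₁])
  have hxy : (PresentedGroup.of 0 : PresentedGroup rels₁) * PresentedGroup.of 1 *
      PresentedGroup.of 0 ^ (-2 : ℤ) * PresentedGroup.of 1 = 1 :=
    PresentedGroup.one_of_mem (rels := rels₁) (by simp [h₁])
  have hγμ : (PresentedGroup.of 2 : PresentedGroup rels₁) *
      PresentedGroup.of 3 ^ (-(g : ℤ)) = 1 :=
    PresentedGroup.one_of_mem (rels := rels₁) (by simp [h₁])
  have hab : (PresentedGroup.of 0 : PresentedGroup rels₂) ^ 2 * PresentedGroup.of 1 ^ n *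
      (PresentedGroup.of 0)⁻¹ * PresentedGroup.of 1 ^ n = 1 :=
    PresentedGroup.one_of_mem (rels := rels₂) (by simp [h₂])
  have hγ : (PresentedGroup.of 2 : PresentedGroup rels₁) = PresentedGroup.of 3 ^ g := by
    simpa [mul_inv_eq_one] using hγμ
  have hy : (PresentedGroup.of 1 : PresentedGroup rels₁) = (PresentedGroup.of 3 ^ n)⁻¹ := by
    rw [eq_inv_of_mul_eq_one_right hγy, hγ, ← pow_mul, hn, mul_comm]
  rw [hy, mul_inv_mul_zpow_neg_two_mul_inv_eq_one_iff] at hxy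
  let b : PresentedGroup rels₂ := PresentedGroup.of 1
  let φ : PresentedGroup rels₁ →* PresentedGroup rels₂ :=
    PresentedGroup.toGroup (f := ![PresentedGroup.of 0, (b ^ n)⁻¹, b ^ g, b]) (by
      subst h₁
      rintro r (rfl | rfl | rfl)
      · simp [hn, ← pow_mul, mul_comm g]
      · simpa [b] using (mul_inv_mul_zpow_neg_two_mul_inv_eq_one_iff _ _).2 hab
      · simp)
  let ψ : PresentedGroup rels₂ →* PresentedGroup rels₁ :=
    PresentedGroup.toGroup (f := ![PresentedGroup.of 0, PresentedGroup.of 3]) (by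
      subst h₂
      rintro r rfl
      simpa using hxy)
  refine ⟨MonoidHom.toMulEquiv φ ψ ?_ ?_, ?_, ?_⟩
  · ext i
    fin_cases i <;> simp [φ, ψ, b, hy, hγ]
  · ext i
    fin_cases i <;> simp [φ, ψ, b]
  · simp [φ]
  · simp [φ, b]
end

section
/- Let m be a non-negative integer and g a positive integer. The presented group ⟨x, y, γ, μ ∣ γ^(2^m) (x y x⁻² y), y, γ μ⁻ᵍ⟩ is an infinite cyclic group generated by the image of μ. -/
/-- A homomorphism to `ℤ` sending a generator of a cyclic group to `1` is bijective. -/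
theorem MonoidHom.bijective_of_zpowers_eq_top {G : Type*} [Group G] {a : G}
    (ha : Subgroup.zpowers a = ⊤) (φ : G →* Multiplicative ℤ)
    (hφ : φ a = Multiplicative.ofAdd 1) : Function.Bijective φ := by
  have map_zpow_generator (n : ℤ) : φ (a ^ n) = Multiplicative.ofAdd n := by
    rw [map_zpow, hφ, ← ofAdd_zsmul, smul_eq_mul, mul_one]
  refine ⟨(injective_iff_map_eq_one φ).2 fun b hb => ?_,
    fun n => ⟨a ^ n.toAdd, map_zpow_generator _⟩⟩
  obtain ⟨n, rfl⟩ := Subgroup.mem_zpowers_iff.1 (ha ▸ Subgroup.mem_top b)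
  rw [map_zpow_generator, ofAdd_eq_one] at hb
  rw [hb, zpow_zero]

/-- A presented group is cyclic if every generator is a power of a fixed element. -/
theorem PresentedGroup.zpowers_eq_top {α : Type*} {rels : Set (FreeGroup α)}
    {a : PresentedGroup rels} (h : ∀ i, PresentedGroup.of i ∈ Subgroup.zpowers a) :
    Subgroup.zpowers a = ⊤ := by
  rw [eq_top_iff, ← PresentedGroup.closure_range_of, Subgroup.closure_le]
  rintro _ ⟨i, rfl⟩
  exact h i

/-- Lemma 6.2(4): ⟨x, y, γ, μ ∣ γ^(2^m) (x y x⁻² y), y, γ μ⁻ᵍ⟩ is infinite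
cyclic generated by the image of μ.  (x = 0, y = 1, γ = 2, μ = 3.) -/
theorem stmt7 (m g : ℕ) (hg : 0 < g) :
    ∀ (rels : Set (FreeGroup (Fin 4))),
      rels = {(FreeGroup.of 2) ^ (2 ^ m) * (FreeGroup.of 0 * FreeGroup.of 1 * (FreeGroup.of 0) ^ (-2 : ℤ) * FreeGroup.of 1),
               FreeGroup.of 1,
               FreeGroup.of 2 * (FreeGroup.of 3) ^ (-(g : ℤ))} →
      (Nonempty (PresentedGroup rels ≃* Multiplicative ℤ) ∧
        Subgroup.zpowers (PresentedGroup.of ((3 : Fin 4)) : PresentedGroup rels) = ⊤) := by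
  intro rels hrels
  have hy : (PresentedGroup.of 1 : PresentedGroup rels) = 1 :=
    PresentedGroup.one_of_mem (by simp [hrels])
  have hγ : (PresentedGroup.of 2 : PresentedGroup rels) = PresentedGroup.of 3 ^ g := by
    have h : PresentedGroup.mk rels (FreeGroup.of 2 * FreeGroup.of 3 ^ (-(g : ℤ))) = 1 :=
      PresentedGroup.one_of_mem (by simp [hrels])
    rw [map_mul, map_zpow, zpow_neg, zpow_natCast] at h
    exact mul_inv_eq_one.1 h
  have hx : (PresentedGroup.of 0 : PresentedGroup rels) = PresentedGroup.of 2 ^ 2 ^ m := by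
    have h : PresentedGroup.mk rels (FreeGroup.of 2 ^ 2 ^ m *
        (FreeGroup.of 0 * FreeGroup.of 1 * FreeGroup.of 0 ^ (-2 : ℤ) * FreeGroup.of 1)) = 1 :=
      PresentedGroup.one_of_mem (by simp [hrels])
    simp only [map_mul, map_zpow, map_pow] at h
    change PresentedGroup.of 2 ^ 2 ^ m * (PresentedGroup.of 0 * PresentedGroup.of 1 *
      PresentedGroup.of 0 ^ (-2 : ℤ) * PresentedGroup.of 1) = 1 at h
    rw [hy, mul_one, mul_one, ← zpow_one_add] at h
    norm_num at h
    exact (mul_inv_eq_one.1 h).symm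
  have hμ : Subgroup.zpowers (PresentedGroup.of 3 : PresentedGroup rels) = ⊤ := by
    have hmem := Subgroup.mem_zpowers (PresentedGroup.of 3 : PresentedGroup rels)
    refine PresentedGroup.zpowers_eq_top fun i => ?_
    fin_cases i
    · change PresentedGroup.of 0 ∈ _
      rw [hx, hγ]
      exact pow_mem (pow_mem hmem _) _
    · change PresentedGroup.of 1 ∈ _
      rw [hy]
      exact one_mem _
    · change PresentedGroup.of 2 ∈ _
      rw [hγ]
      exact pow_mem hmem _
    · exact hmem
  let f : Fin 4 → Multiplicative ℤ :=
    ![(Multiplicative.ofAdd 1 ^ g) ^ 2 ^ m, 1, Multiplicative.ofAdd 1 ^ g, Multiplicative.ofAdd 1]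
  have hf : ∀ r ∈ rels, FreeGroup.lift f r = 1 := by
    rw [hrels]
    rintro r (rfl | rfl | rfl)
    · simp only [map_mul, map_pow, map_zpow, FreeGroup.lift_apply_of]
      change (Multiplicative.ofAdd (1 : ℤ) ^ g) ^ 2 ^ m *
        ((Multiplicative.ofAdd 1 ^ g) ^ 2 ^ m * 1 *
          ((Multiplicative.ofAdd 1 ^ g) ^ 2 ^ m) ^ (-2 : ℤ) * 1) = 1
      group
    · simp [f]
    · simp [f]
  exact ⟨⟨MulEquiv.ofBijective (PresentedGroup.toGroup hf)
    (MonoidHom.bijective_of_zpowers_eq_top hμ _ (PresentedGroup.toGroup.of hf))⟩, hμ⟩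
end

section
/- Let m, l, k₀, k₁, k₂ be non-negative integers and let G be the presented group ⟨x, y, γ ∣ (γ^(2^m) (x y x⁻¹ y⁻¹)^(2^l))^(2^k₀), x^(2^k₁), y^(2^k₂)⟩. Then the abelianization of G is a finite group; in particular, it is not an infinite cyclic group generated by the image of γ. -/
theorem CommGroup.finite_of_closure_eq_top {A : Type*} [CommGroup A] {s : Set A}
    (hs : s.Finite) (hclosure : Subgroup.closure s = ⊤) (hfin : ∀ a ∈ s, IsOfFinOrder a) :
    Finite A := by
  have : Group.FG A := Group.fg_iff.2 ⟨s, hclosure, hs⟩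
  have htop : CommGroup.torsion A = ⊤ :=
    top_le_iff.1 (hclosure ▸ (Subgroup.closure_le (CommGroup.torsion A)).2 hfin)
  exact CommGroup.finite_of_fg_isMulTorsion A fun a => htop.ge (Subgroup.mem_top a)

theorem PresentedGroup.closure_range_abelianization_of {α : Type*} (rels : Set (FreeGroup α)) :
    Subgroup.closure (Set.range fun i =>
      Abelianization.of (PresentedGroup.of i : PresentedGroup rels)) = ⊤ := by
  rw [Set.range_comp' Abelianization.of, ← MonoidHom.map_closure,
    PresentedGroup.closure_range_of, Subgroup.map_top_of_surjective]
  exact QuotientGroup.mk_surjective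

/-- Lemma 6.3(2): the abelianization of
⟨x, y, γ ∣ (γ^(2^m) (x y x⁻¹ y⁻¹)^(2^l))^(2^k₀), x^(2^k₁), y^(2^k₂)⟩ is finite;
in particular it is not infinite cyclic generated by the image of γ. -/
theorem stmt10 (m l k₀ k₁ k₂ : ℕ) :
    ∀ (rels : Set (FreeGroup (Fin 3))),
      rels = {((FreeGroup.of 2) ^ (2 ^ m) * (FreeGroup.of 0 * FreeGroup.of 1 * (FreeGroup.of 0)⁻¹ * (FreeGroup.of 1)⁻¹) ^ (2 ^ l)) ^ (2 ^ k₀),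
               (FreeGroup.of 0) ^ (2 ^ k₁),
               (FreeGroup.of 1) ^ (2 ^ k₂)} →
      (Finite (Abelianization (PresentedGroup rels)) ∧
        ¬(Nonempty (Abelianization (PresentedGroup rels) ≃* Multiplicative ℤ) ∧
          Subgroup.zpowers (Abelianization.of (PresentedGroup.of ((2 : Fin 3)) : PresentedGroup rels)) = ⊤)) := by
  intro rels hrels
  let φ : FreeGroup (Fin 3) →* Abelianization (PresentedGroup rels) :=
    Abelianization.of.comp (PresentedGroup.mk rels)
  have hφ : ∀ r ∈ rels, φ r = 1 := fun r hr => by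
    simp [φ, PresentedGroup.one_of_mem hr]
  have hγ : φ (FreeGroup.of 2) ^ (2 ^ m * 2 ^ k₀) = 1 := by
    have h := hφ _ (hrels.ge <| Or.inl rfl)
    simpa [mul_inv_cancel_comm, pow_mul] using h
  have hx : φ (FreeGroup.of 0) ^ 2 ^ k₁ = 1 := by
    rw [← map_pow]
    exact hφ _ (hrels.ge <| Or.inr (Or.inl rfl))
  have hy : φ (FreeGroup.of 1) ^ 2 ^ k₂ = 1 := by
    rw [← map_pow]
    exact hφ _ (hrels.ge <| Or.inr (Or.inr rfl))
  have hfinite : Finite (Abelianization (PresentedGroup rels)) := by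
    refine CommGroup.finite_of_closure_eq_top (Set.finite_range _)
      (PresentedGroup.closure_range_abelianization_of rels) ?_
    rintro _ ⟨i, rfl⟩
    fin_cases i
    · exact isOfFinOrder_iff_pow_eq_one.2 ⟨_, by positivity, hx⟩
    · exact isOfFinOrder_iff_pow_eq_one.2 ⟨_, by positivity, hy⟩
    · exact isOfFinOrder_iff_pow_eq_one.2 ⟨_, by positivity, hγ⟩
  refine ⟨hfinite, ?_⟩
  rintro ⟨⟨e⟩, -⟩
  have : Finite (Multiplicative ℤ) := Finite.of_equiv _ e.toEquiv
  exact not_finite (Multiplicative ℤ)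
end

section
/- Let m, l, k₀, k₁, k₂ be non-negative integers and let G be the presented group ⟨x, y, γ ∣ (γ^(2^m) x^(2^l))^(2^k₀), y^(2^k₁), (x y x y⁻¹)^(2^k₂)⟩. Then the abelianization of G is a finite group; in particular, it is not an infinite cyclic group generated by the image of γ. -/
/-- A commutative quotient of a free group of finite rank is finite as soon as the images of
the generators have finite order. -/
theorem finite_of_surjective_freeGroup {α A : Type*} [Finite α] [CommGroup A]
    (f : FreeGroup α →* A) (hf : Function.Surjective f)
    (h : ∀ i, IsOfFinOrder (f (FreeGroup.of i))) : Finite A := by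
  have : Group.FG A := Group.fg_of_surjective hf
  have hle : (⊤ : Subgroup (FreeGroup α)) ≤ (CommGroup.torsion A).comap f := by
    rw [← FreeGroup.closure_range_of, Subgroup.closure_le]
    rintro _ ⟨i, rfl⟩
    exact h i
  refine CommGroup.finite_of_fg_isMulTorsion A fun a => ?_
  obtain ⟨w, rfl⟩ := hf a
  exact hle (Subgroup.mem_top w)


/-- Lemma 6.3(3): the abelianization of
⟨x, y, γ ∣ (γ^(2^m) x^(2^l))^(2^k₀), y^(2^k₁), (x y x y⁻¹)^(2^k₂)⟩ is finite;
in particular it is not infinite cyclic generated by the image of γ. -/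
theorem stmt11 (m l k₀ k₁ k₂ : ℕ) :
    ∀ (rels : Set (FreeGroup (Fin 3))),
      rels = {((FreeGroup.of 2) ^ (2 ^ m) * (FreeGroup.of 0) ^ (2 ^ l)) ^ (2 ^ k₀),
               (FreeGroup.of 1) ^ (2 ^ k₁),
               (FreeGroup.of 0 * FreeGroup.of 1 * FreeGroup.of 0 * (FreeGroup.of 1)⁻¹) ^ (2 ^ k₂)} →
      (Finite (Abelianization (PresentedGroup rels)) ∧
        ¬(Nonempty (Abelianization (PresentedGroup rels) ≃* Multiplicative ℤ) ∧
          Subgroup.zpowers (Abelianization.of (PresentedGroup.of ((2 : Fin 3)) : PresentedGroup rels)) = ⊤)) := by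
  intro rels hrels
  let f : FreeGroup (Fin 3) →* Abelianization (PresentedGroup rels) :=
    Abelianization.of.comp (PresentedGroup.mk rels)
  have hf : Function.Surjective f :=
    (QuotientGroup.mk_surjective).comp (PresentedGroup.mk_surjective rels)
  have hrel : ∀ r ∈ rels, f r = 1 := fun r hr => by
    change Abelianization.of (PresentedGroup.mk rels r) = 1
    rw [PresentedGroup.one_of_mem hr, map_one]
  have htwo : ∀ n : ℕ, 2 ^ n ≠ 0 := fun n => by positivity
  replace hrel := fun r hr => hrel r (hrels.ge hr)
  simp only [Set.mem_insert_iff, Set.mem_singleton_iff, forall_eq_or_imp, forall_eq,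
    map_mul, map_pow, map_inv] at hrel
  obtain ⟨hγx, hy, hxx⟩ := hrel
  have hyfin : IsOfFinOrder (f (FreeGroup.of 1)) :=
    isOfFinOrder_iff_pow_eq_one.2 ⟨_, Nat.pos_of_ne_zero (htwo k₁), hy⟩
  have hxfin : IsOfFinOrder (f (FreeGroup.of 0)) := by
    rw [mul_right_comm (f (FreeGroup.of 0)), mul_inv_cancel_right, ← pow_two, ← pow_mul] at hxx
    exact isOfFinOrder_iff_pow_eq_one.2 ⟨_, by positivity, hxx⟩
  have hγfin : IsOfFinOrder (f (FreeGroup.of 2)) := by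
    have hprod := isOfFinOrder_iff_pow_eq_one.2 ⟨_, Nat.pos_of_ne_zero (htwo k₀), hγx⟩
    have hpow := hprod.mul (hxfin.pow (n := 2 ^ l)).inv
    rw [mul_inv_cancel_right] at hpow
    exact hpow.of_pow (htwo m)
  have hfin : Finite (Abelianization (PresentedGroup rels)) :=
    finite_of_surjective_freeGroup f hf fun i => by
      fin_cases i
      exacts [hxfin, hyfin, hγfin]
  refine ⟨hfin, ?_⟩
  rintro ⟨⟨e⟩, -⟩
  exact not_finite_iff_infinite.2 (inferInstance : Infinite (Multiplicative ℤ))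
    (Finite.of_equiv _ e.toEquiv)
end

section
/- Let m and k₂ be non-negative integers and g a positive integer. The presented group ⟨x, y, γ, μ ∣ γ^(2^m) y, x, (x y x y⁻¹)^(2^k₂), γ μ⁻ᵍ⟩ is an infinite cyclic group generated by the image of μ. -/
/-- Lemma 6.3(4), knot group: ⟨x, y, γ, μ ∣ γ^(2^m) y, x, (x y x y⁻¹)^(2^k₂),
γ μ⁻ᵍ⟩ is infinite cyclic generated by the image of μ.  (x = 0, y = 1, γ = 2, μ = 3.) -/
theorem stmt13 (m k₂ g : ℕ) (hg : 0 < g) :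
    ∀ (rels : Set (FreeGroup (Fin 4))),
      rels = {(FreeGroup.of 2) ^ (2 ^ m) * FreeGroup.of 1,
               FreeGroup.of 0,
               (FreeGroup.of 0 * FreeGroup.of 1 * FreeGroup.of 0 * (FreeGroup.of 1)⁻¹) ^ (2 ^ k₂),
               FreeGroup.of 2 * (FreeGroup.of 3) ^ (-(g : ℤ))} →
      (Nonempty (PresentedGroup rels ≃* Multiplicative ℤ) ∧
        Subgroup.zpowers (PresentedGroup.of ((3 : Fin 4)) : PresentedGroup rels) = ⊤) := by
  intro rels hrels
  have hgen : Subgroup.zpowers (PresentedGroup.of (3 : Fin 4) : PresentedGroup rels) = ⊤ := by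
    have hx : (PresentedGroup.of 0 : PresentedGroup rels) = 1 :=
      PresentedGroup.one_of_mem (by simp [hrels])
    have hy : (PresentedGroup.of 2 : PresentedGroup rels) ^ (2 ^ m) * PresentedGroup.of 1 = 1 :=
      PresentedGroup.one_of_mem (x := FreeGroup.of 2 ^ (2 ^ m) * FreeGroup.of 1) (by simp [hrels])
    have hγ : (PresentedGroup.of 2 : PresentedGroup rels) *
        PresentedGroup.of 3 ^ (-(g : ℤ)) = 1 :=
      PresentedGroup.one_of_mem (x := FreeGroup.of 2 * FreeGroup.of 3 ^ (-(g : ℤ)))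
        (by simp [hrels])
    have hγmem : (PresentedGroup.of 2 : PresentedGroup rels) ∈
        Subgroup.zpowers (PresentedGroup.of 3 : PresentedGroup rels) := by
      rw [eq_inv_of_mul_eq_one_left hγ]
      exact inv_mem (Subgroup.zpow_mem_zpowers _ _)
    rw [eq_top_iff, ← PresentedGroup.closure_range_of, Subgroup.closure_le]
    rintro _ ⟨i, rfl⟩
    fin_cases i
    · exact hx ▸ one_mem _
    · exact eq_inv_of_mul_eq_one_right hy ▸ inv_mem (pow_mem hγmem _)
    · exact hγmem
    · exact Subgroup.mem_zpowers _
  refine ⟨?_, hgen⟩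
  let v : Fin 4 → Multiplicative ℤ := ![1, Multiplicative.ofAdd (-(2 ^ m * g : ℤ)),
    Multiplicative.ofAdd (g : ℤ), Multiplicative.ofAdd 1]
  have hv : ∀ r ∈ rels, FreeGroup.lift v r = 1 := by
    subst hrels
    rintro r (rfl | rfl | rfl | rfl)
    · simp [v, ← ofAdd_nsmul]
    · simp [v]
    · simp [v]
    · simp [v, ← ofAdd_nsmul]
  exact nonempty_mulEquiv_int_of_zpowers_eq_top hgen (PresentedGroup.toGroup hv)
    (PresentedGroup.toGroup.of hv)
end

section
/- Let m, l, k₀, k₁, k₂ be non-negative integers and let G be the presented group ⟨x, y, γ ∣ (γ^(2^m) x^(2^l))^(2^k₀), (x y)^(2^k₁), (x y⁻²)^(2^k₂)⟩. Then the abelianization of G is a finite group; in particular, it is not an infinite cyclic group generated by the image of γ. -/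
/-- If three elements of a commutative group satisfy power relations of the shape
`(γ ^ a * x ^ b) ^ c`, `(x * y) ^ d`, `(x * y⁻²) ^ e` with nonzero exponents, they all have finite
order. -/
theorem isOfFinOrder_of_three_relations {A : Type*} [CommGroup A] {x y γ : A} {a b c d e : ℕ}
    (ha : a ≠ 0) (hc : c ≠ 0) (hd : d ≠ 0) (he : e ≠ 0)
    (h₀ : (γ ^ a * x ^ b) ^ c = 1) (h₁ : (x * y) ^ d = 1) (h₂ : (x * y ^ (-2 : ℤ)) ^ e = 1) :
    IsOfFinOrder x ∧ IsOfFinOrder y ∧ IsOfFinOrder γ := by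
  have of_pow_eq_one {g : A} {n : ℕ} (hn : n ≠ 0) (h : g ^ n = 1) : IsOfFinOrder g :=
    isOfFinOrder_iff_pow_eq_one.2 ⟨n, Nat.pos_of_ne_zero hn, h⟩
  have hxy := of_pow_eq_one hd h₁
  have hy : IsOfFinOrder y := by
    have h := hxy.mul (of_pow_eq_one he h₂).inv
    have hcube : x * y * (x * y ^ (-2 : ℤ))⁻¹ = y ^ 3 := by
      rw [mul_inv, zpow_neg, inv_inv, mul_mul_mul_comm, mul_inv_cancel, one_mul, pow_succ']
      norm_cast
    rw [hcube] at h
    exact h.of_pow three_ne_zero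
  have hx : IsOfFinOrder x := by simpa using hxy.mul hy.inv
  refine ⟨hx, hy, ?_⟩
  have h := (of_pow_eq_one hc h₀).mul (hx.pow (n := b)).inv
  rw [mul_inv_cancel_right] at h
  exact h.of_pow ha

/-- The abelianization of a finitely generated presented group is finite as soon as the images of
the generators have finite order. -/
theorem PresentedGroup.finite_abelianization {α : Type*} [Finite α] {rels : Set (FreeGroup α)}
    (h : ∀ i, IsOfFinOrder (Abelianization.of (PresentedGroup.of i : PresentedGroup rels))) :
    Finite (Abelianization (PresentedGroup rels)) := by
  have : Group.FG (PresentedGroup rels) :=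
    Group.fg_of_surjective (PresentedGroup.mk_surjective rels)
  have : Group.FG (Abelianization (PresentedGroup rels)) :=
    Group.fg_of_surjective (f := Abelianization.of) QuotientGroup.mk_surjective
  refine CommGroup.finite_of_fg_isMulTorsion _ fun g => ?_
  obtain ⟨g, rfl⟩ := QuotientGroup.mk_surjective g
  have hle : (⊤ : Subgroup (PresentedGroup rels)) ≤
      (CommGroup.torsion (Abelianization (PresentedGroup rels))).comap Abelianization.of := by
    rw [← PresentedGroup.closure_range_of, Subgroup.closure_le]
    rintro _ ⟨i, rfl⟩
    exact h i
  exact hle (Subgroup.mem_top g)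

/-- Lemma 6.3(6): the abelianization of
⟨x, y, γ ∣ (γ^(2^m) x^(2^l))^(2^k₀), (x y)^(2^k₁), (x y⁻²)^(2^k₂)⟩ is finite;
in particular it is not infinite cyclic generated by the image of γ. -/
theorem stmt15 (m l k₀ k₁ k₂ : ℕ) :
    ∀ (rels : Set (FreeGroup (Fin 3))),
      rels = {((FreeGroup.of 2) ^ (2 ^ m) * (FreeGroup.of 0) ^ (2 ^ l)) ^ (2 ^ k₀),
               (FreeGroup.of 0 * FreeGroup.of 1) ^ (2 ^ k₁),
               (FreeGroup.of 0 * (FreeGroup.of 1) ^ (-2 : ℤ)) ^ (2 ^ k₂)} →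
      (Finite (Abelianization (PresentedGroup rels)) ∧
        ¬(Nonempty (Abelianization (PresentedGroup rels) ≃* Multiplicative ℤ) ∧
          Subgroup.zpowers (Abelianization.of (PresentedGroup.of ((2 : Fin 3)) : PresentedGroup rels)) = ⊤)) := by
  intro rels hrels
  let φ : FreeGroup (Fin 3) →* Abelianization (PresentedGroup rels) :=
    Abelianization.of.comp (PresentedGroup.mk rels)
  have hφ {r : FreeGroup (Fin 3)} (hr : r ∈ rels) : φ r = 1 := by
    simp [φ, PresentedGroup.one_of_mem hr]
  have h₀ := hφ (hrels ▸ Set.mem_insert _ _)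
  have h₁ := hφ (hrels ▸ Set.mem_insert_of_mem _ (Set.mem_insert _ _))
  have h₂ := hφ (hrels ▸ Set.mem_insert_of_mem _ (Set.mem_insert_of_mem _ (Set.mem_singleton _)))
  simp only [map_mul, map_pow, map_zpow] at h₀ h₁ h₂
  have two_pow_ne_zero (n : ℕ) : 2 ^ n ≠ 0 := pow_ne_zero n two_ne_zero
  obtain ⟨hx, hy, hγ⟩ := isOfFinOrder_of_three_relations (two_pow_ne_zero m)
    (two_pow_ne_zero k₀) (two_pow_ne_zero k₁) (two_pow_ne_zero k₂) h₀ h₁ h₂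
  have hfin : Finite (Abelianization (PresentedGroup rels)) := by
    refine PresentedGroup.finite_abelianization fun i => ?_
    fin_cases i
    exacts [hx, hy, hγ]
  refine ⟨hfin, ?_⟩
  rintro ⟨⟨e⟩, -⟩
  have : Finite (Multiplicative ℤ) := Finite.of_equiv _ e.toEquiv
  exact not_finite (Multiplicative ℤ)
end

section
/- Let m, l, k₀, k₁, k₂, k₃ be non-negative integers and let G be the presented group ⟨x, y, γ ∣ (γ^(2^m) x^(2^l))^(2^k₀), y^(2^k₁), (x y)^(2^k₂), (x y⁻¹)^(2^k₃)⟩. Then the abelianization of G is a finite group; in particular, it is not an infinite cyclic group generated by the image of γ. -/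
/-- A commutative group generated by a finite family of elements of finite order is finite. -/
theorem CommGroup.finite_of_closure_range_eq_top {A ι : Type*} [CommGroup A] [Finite ι]
    (g : ι → A) (hg : Subgroup.closure (Set.range g) = ⊤) (hfin : ∀ i, IsOfFinOrder (g i)) :
    Finite A := by
  have : Group.FG A := Group.fg_iff.mpr ⟨Set.range g, hg, Set.finite_range g⟩
  have hle : Subgroup.closure (Set.range g) ≤ CommGroup.torsion A := by
    rw [Subgroup.closure_le]
    rintro _ ⟨i, rfl⟩
    exact hfin i
  refine CommGroup.finite_of_fg_isMulTorsion A fun a => hle ?_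
  rw [hg]
  trivial

theorem IsOfFinOrder.of_pow_eq_one {G : Type*} [Monoid G] {g : G} {n : ℕ} (hn : 0 < n)
    (h : g ^ n = 1) : IsOfFinOrder g :=
  isOfFinOrder_iff_pow_eq_one.mpr ⟨n, hn, h⟩

theorem IsOfFinOrder.of_mul_right {A : Type*} [CommGroup A] {a b : A}
    (hab : IsOfFinOrder (a * b)) (hb : IsOfFinOrder b) : IsOfFinOrder a := by
  simpa using hab.mul hb.inv

/-- Lemma 6.4(1): the abelianization of
⟨x, y, γ ∣ (γ^(2^m) x^(2^l))^(2^k₀), y^(2^k₁), (x y)^(2^k₂), (x y⁻¹)^(2^k₃)⟩ is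
finite; in particular it is not infinite cyclic generated by the image of γ. -/
theorem stmt18 (m l k₀ k₁ k₂ k₃ : ℕ) :
    ∀ (rels : Set (FreeGroup (Fin 3))),
      rels = {((FreeGroup.of 2) ^ (2 ^ m) * (FreeGroup.of 0) ^ (2 ^ l)) ^ (2 ^ k₀),
               (FreeGroup.of 1) ^ (2 ^ k₁),
               (FreeGroup.of 0 * FreeGroup.of 1) ^ (2 ^ k₂),
               (FreeGroup.of 0 * (FreeGroup.of 1)⁻¹) ^ (2 ^ k₃)} →
      (Finite (Abelianization (PresentedGroup rels)) ∧
        ¬(Nonempty (Abelianization (PresentedGroup rels) ≃* Multiplicative ℤ) ∧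
          Subgroup.zpowers (Abelianization.of (PresentedGroup.of ((2 : Fin 3)) : PresentedGroup rels)) = ⊤)) := by
  intro rels hrels
  let φ : FreeGroup (Fin 3) →* Abelianization (PresentedGroup rels) :=
    Abelianization.of.comp (PresentedGroup.mk rels)
  have hφ : ∀ r ∈ rels, φ r = 1 := fun r hr => by
    change Abelianization.of (PresentedGroup.mk rels r) = 1
    rw [PresentedGroup.one_of_mem hr, map_one]
  have two_pow_pos : ∀ n : ℕ, 0 < 2 ^ n := fun n => by positivity
  have hy : IsOfFinOrder (φ (FreeGroup.of 1)) :=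
    .of_pow_eq_one (two_pow_pos k₁) (by rw [← map_pow]; exact hφ _ (by simp [hrels]))
  have hxy : IsOfFinOrder (φ (FreeGroup.of 0) * φ (FreeGroup.of 1)) :=
    .of_pow_eq_one (two_pow_pos k₂) (by rw [← map_mul, ← map_pow]; exact hφ _ (by simp [hrels]))
  have hx : IsOfFinOrder (φ (FreeGroup.of 0)) := hxy.of_mul_right hy
  have hγx : IsOfFinOrder (φ (FreeGroup.of 2) ^ 2 ^ m * φ (FreeGroup.of 0) ^ 2 ^ l) :=
    .of_pow_eq_one (two_pow_pos k₀) (by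
      simp only [← map_pow, ← map_mul]; exact hφ _ (by simp [hrels]))
  have hγ : IsOfFinOrder (φ (FreeGroup.of 2)) :=
    (hγx.of_mul_right hx.pow).of_pow (two_pow_pos m).ne'
  have hfinite : Finite (Abelianization (PresentedGroup rels)) := by
    refine CommGroup.finite_of_closure_range_eq_top _
      (PresentedGroup.closure_range_abelianization_of rels) fun i => ?_
    fin_cases i
    exacts [hx, hy, hγ]
  refine ⟨hfinite, fun ⟨⟨e⟩, _⟩ => ?_⟩
  have : Finite (Multiplicative ℤ) := Finite.of_equiv _ e.toEquiv
  exact not_finite (Multiplicative ℤ)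
end

section
/- Let m, l, k₀, k₁, k₂, k₃ be non-negative integers and let G be the presented group ⟨x, y, γ ∣ (γ^(2^m) (x y)^(2^l))^(2^k₀), x^(2^k₁), y^(2^k₂), (x y⁻¹)^(2^k₃)⟩. Then the abelianization of G is a finite group; in particular, it is not an infinite cyclic group generated by the image of γ. -/
/-- The abelianization of a finitely generated presented group is finite as soon as every generator
has finite order in it. -/
theorem PresentedGroup.finite_abelianization_of_isOfFinOrder {α : Type*} [Finite α]
    {rels : Set (FreeGroup α)}
    (h : ∀ a, IsOfFinOrder (Abelianization.of (PresentedGroup.of a : PresentedGroup rels))) :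
    Finite (Abelianization (PresentedGroup rels)) := by
  have hsurj : Function.Surjective (Abelianization.of (G := PresentedGroup rels)) :=
    QuotientGroup.mk_surjective
  have hclosure : Subgroup.closure
      (Set.range fun a ↦ Abelianization.of (PresentedGroup.of a : PresentedGroup rels)) = ⊤ := by
    rw [← Function.comp_def, Set.range_comp, ← MonoidHom.map_closure,
      PresentedGroup.closure_range_of, Subgroup.map_top_of_surjective _ hsurj]
  have hfg : Group.FG (Abelianization (PresentedGroup rels)) :=
    Group.fg_iff.mpr ⟨_, hclosure, Set.finite_range _⟩
  have htorsion : CommGroup.torsion (Abelianization (PresentedGroup rels)) = ⊤ := by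
    rw [eq_top_iff, ← hclosure, Subgroup.closure_le]
    rintro _ ⟨a, rfl⟩
    exact h a
  refine CommGroup.finite_of_fg_isMulTorsion _ fun g ↦ ?_
  have hg : g ∈ CommGroup.torsion (Abelianization (PresentedGroup rels)) :=
    htorsion ▸ Subgroup.mem_top g
  exact hg

/-- In a commutative group, if `g ^ n * w` and `w` have finite order with `n ≠ 0`, so does `g`. -/
theorem IsOfFinOrder.of_pow_mul {A : Type*} [CommGroup A] {g w : A} {n : ℕ} (hn : n ≠ 0)
    (hgw : IsOfFinOrder (g ^ n * w)) (hw : IsOfFinOrder w) : IsOfFinOrder g := by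
  have hpow : IsOfFinOrder (g ^ n) := by simpa using hgw.mul hw.inv
  exact hpow.of_pow hn

/-- If a homomorphism to a commutative group kills `(γ ^ n * (x * y) ^ q) ^ p`, `x ^ r` and `y ^ s`,
where `n`, `p`, `r`, `s` are nonzero, then the images of `x`, `y`, `γ` have finite order. -/
theorem FreeGroup.isOfFinOrder_map_of {A : Type*} [CommGroup A] (φ : FreeGroup (Fin 3) →* A)
    {n p q r s : ℕ} (hn : n ≠ 0) (hp : 0 < p) (hr : 0 < r) (hs : 0 < s)
    (hγ : φ ((of 2 ^ n * (of 0 * of 1) ^ q) ^ p) = 1) (hx : φ (of 0 ^ r) = 1)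
    (hy : φ (of 1 ^ s) = 1) (a : Fin 3) : IsOfFinOrder (φ (of a)) := by
  simp only [map_pow, _root_.map_mul] at hγ hx hy
  have hx' : IsOfFinOrder (φ (of 0)) := isOfFinOrder_iff_pow_eq_one.mpr ⟨r, hr, hx⟩
  have hy' : IsOfFinOrder (φ (of 1)) := isOfFinOrder_iff_pow_eq_one.mpr ⟨s, hs, hy⟩
  have hγ' : IsOfFinOrder (φ (of 2)) :=
    .of_pow_mul hn (isOfFinOrder_iff_pow_eq_one.mpr ⟨p, hp, hγ⟩) (hx'.mul hy').pow
  fin_cases a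
  exacts [hx', hy', hγ']

/-- Lemma 6.4(2): the abelianization of
⟨x, y, γ ∣ (γ^(2^m) (x y)^(2^l))^(2^k₀), x^(2^k₁), y^(2^k₂), (x y⁻¹)^(2^k₃)⟩ is
finite; in particular it is not infinite cyclic generated by the image of γ. -/
theorem stmt19 (m l k₀ k₁ k₂ k₃ : ℕ) :
    ∀ (rels : Set (FreeGroup (Fin 3))),
      rels = {((FreeGroup.of 2) ^ (2 ^ m) * (FreeGroup.of 0 * FreeGroup.of 1) ^ (2 ^ l)) ^ (2 ^ k₀),
               (FreeGroup.of 0) ^ (2 ^ k₁),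
               (FreeGroup.of 1) ^ (2 ^ k₂),
               (FreeGroup.of 0 * (FreeGroup.of 1)⁻¹) ^ (2 ^ k₃)} →
      (Finite (Abelianization (PresentedGroup rels)) ∧
        ¬(Nonempty (Abelianization (PresentedGroup rels) ≃* Multiplicative ℤ) ∧
          Subgroup.zpowers (Abelianization.of (PresentedGroup.of ((2 : Fin 3)) : PresentedGroup rels)) = ⊤)) := by
  intro rels hrels
  have hrel (r : FreeGroup (Fin 3)) (hr : r ∈ rels) :
      Abelianization.of (PresentedGroup.mk rels r) = 1 := by
    rw [PresentedGroup.one_of_mem hr, map_one]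
  have hfinite : Finite (Abelianization (PresentedGroup rels)) :=
    PresentedGroup.finite_abelianization_of_isOfFinOrder <|
      FreeGroup.isOfFinOrder_map_of (Abelianization.of.comp (PresentedGroup.mk rels))
        (Nat.two_pow_pos m).ne' (Nat.two_pow_pos k₀) (Nat.two_pow_pos k₁) (Nat.two_pow_pos k₂)
        (hrel ((.of 2 ^ 2 ^ m * (.of 0 * .of 1) ^ 2 ^ l) ^ 2 ^ k₀) (by simp [hrels]))
        (hrel (.of 0 ^ 2 ^ k₁) (by simp [hrels])) (hrel (.of 1 ^ 2 ^ k₂) (by simp [hrels]))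
  refine ⟨hfinite, ?_⟩
  rintro ⟨⟨e⟩, -⟩
  have : Finite (Multiplicative ℤ) := Finite.of_equiv _ e.toEquiv
  exact not_finite (Multiplicative ℤ)
end
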